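/- Maximal correlation satisfies the data processing inequality under local quantum channels: if Φ is a completely positive trace-preserving map from d_A × d_A matrices to d_{A'} × d_{A'} matrices (given by Kraus operators K_k with Σ_k K_k† K_k = I) and Ψ is a completely positive trace-preserving map from d_B × d_B matrices to d_{B'} × d_{B'} matrices (given by Kraus operators L_m with Σ_m L_m† L_m = I), then for every bipartite density matrix ρ_AB, the state σ_{A'B'} = (Φ ⊗ Ψ)(ρ_AB) satisfies μ(σ_{A'B'}) ≤ μ(ρ_AB). -/

import Mathlib

open scoped Matrix Kronecker ComplexOrder
open Matrix

noncomputable section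

/-- Partial trace over the second (B) system. -/
def ptrB {A B : Type*} [Fintype B] (ρ : Matrix (A × B) (A × B) ℂ) : Matrix A A ℂ :=
  fun i j => ∑ k, ρ (i, k) (j, k)

/-- Partial trace over the first (A) system. -/
def ptrA {A B : Type*} [Fintype A] (ρ : Matrix (A × B) (A × B) ℂ) : Matrix B B ℂ :=
  fun k l => ∑ i, ρ (i, k) (i, l)

/-- A density matrix: positive semidefinite with trace one. -/
def IsDensity {n : Type*} [Fintype n] (ρ : Matrix n n ℂ) : Prop :=
  ρ.PosSemidef ∧ ρ.trace = 1

/-- Maximal correlation of a bipartite state. -/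
def mu {A B : Type*} [Fintype A] [Fintype B] (ρ : Matrix (A × B) (A × B) ℂ) : ℝ :=
  sSup {r : ℝ | ∃ (X : Matrix A A ℂ) (Y : Matrix B B ℂ),
    ((ptrB ρ) * X).trace = 0 ∧ ((ptrA ρ) * Y).trace = 0 ∧
    ((ptrB ρ) * (X * Xᴴ)).trace = 1 ∧ ((ptrA ρ) * (Y * Yᴴ)).trace = 1 ∧
    r = ‖(ρ * (X ⊗ₖ Yᴴ)).trace‖}

/-- Maximal entanglement: infimum over finite decompositions of the max correlation. -/
def muEnt {A B : Type*} [Fintype A] [Fintype B] (ρ : Matrix (A × B) (A × B) ℂ) : ℝ :=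
  sInf {r : ℝ | ∃ (m : ℕ) (p : Fin m → ℝ) (τ : Fin m → Matrix (A × B) (A × B) ℂ),
    (∀ i, 0 ≤ p i) ∧ (∑ i, p i) = 1 ∧ (∀ i, IsDensity (τ i)) ∧
    ρ = ∑ i, p i • τ i ∧ r = ⨆ i, mu (τ i)}

/-- Application of a product channel given by local Kraus operators. -/
def applyLocal {A B A' B' ι κ : Type*} [Fintype A] [Fintype B] [Fintype ι] [Fintype κ]
    (K : ι → Matrix A' A ℂ) (L : κ → Matrix B' B ℂ)
    (ρ : Matrix (A × B) (A × B) ℂ) : Matrix (A' × B') (A' × B') ℂ :=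
  ∑ k, ∑ m, (K k ⊗ₖ L m) * ρ * (K k ⊗ₖ L m)ᴴ

/-- Tensor product of two bipartite states, with the A-systems grouped together. -/
def prodState {A B A' B' : Type*}
    (ρ : Matrix (A × B) (A × B) ℂ) (σ : Matrix (A' × B') (A' × B') ℂ) :
    Matrix ((A × A') × (B × B')) ((A × A') × (B × B')) ℂ :=
  fun x y => ρ (x.1.1, x.2.1) (y.1.1, y.2.1) * σ (x.1.2, x.2.2) (y.1.2, y.2.2)

/-- n-fold tensor power of a bipartite state, with all A-systems grouped together. -/
def powState {A B : Type*} (ρ : Matrix (A × B) (A × B) ℂ) (n : ℕ) :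
    Matrix ((Fin n → A) × (Fin n → B)) ((Fin n → A) × (Fin n → B)) ℂ :=
  fun x y => ∏ i, ρ (x.1 i, x.2 i) (y.1 i, y.2 i)

/-- The two-qubit Bell vector (|00⟩+|11⟩)/√2. -/
def bellVec : Fin 2 × Fin 2 → ℂ := fun p => if p.1 = p.2 then 1 / (Real.sqrt 2 : ℂ) else 0

/-- Inverse of the positive semidefinite square root. -/
def invSqrt {n : Type*} [Fintype n] [DecidableEq n] (M : Matrix n n ℂ) : Matrix n n ℂ :=
  letI := Classical.dec M.PosSemidef
  if h : M.PosSemidef then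
    ((h.1.eigenvectorUnitary : Matrix n n ℂ) *
      diagonal ((RCLike.ofReal : ℝ → ℂ) ∘ Real.sqrt ∘ h.1.eigenvalues) *
      (star h.1.eigenvectorUnitary : Matrix n n ℂ))⁻¹ else 0


section Aux

variable {A B A' B' ι κ n : Type*} [Fintype A'] [Fintype B'] [Fintype ι] [Fintype κ] [Fintype n]

/-- The Heisenberg-picture map `X ↦ ∑ₖ Kₖ† X Kₖ` of a channel with Kraus operators `Kₖ`. -/
def krausDual (K : ι → Matrix A' A ℂ) (X : Matrix A' A' ℂ) : Matrix A A ℂ :=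
  ∑ k, (K k)ᴴ * X * K k

lemma conjTranspose_krausDual (K : ι → Matrix A' A ℂ) (X : Matrix A' A' ℂ) :
    (krausDual K X)ᴴ = krausDual K Xᴴ := by
  simp [krausDual, conjTranspose_sum, Matrix.mul_assoc]

lemma krausDual_one [DecidableEq A] [DecidableEq A'] {K : ι → Matrix A' A ℂ}
    (hK : ∑ k, (K k)ᴴ * K k = 1) : krausDual K 1 = 1 := by
  simpa [krausDual] using hK

variable [Fintype A] [Fintype B]

lemma trace_ptrB_mul [DecidableEq B] (ρ : Matrix (A × B) (A × B) ℂ) (X : Matrix A A ℂ) :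
    (ptrB ρ * X).trace = (ρ * (X ⊗ₖ (1 : Matrix B B ℂ))).trace := by
  simp only [trace, diag_apply, mul_apply, ptrB, kroneckerMap_apply, Fintype.sum_prod_type,
    one_apply, mul_ite, mul_one, mul_zero, Finset.sum_ite_eq', Finset.mem_univ, if_true,
    Finset.sum_mul]
  exact Finset.sum_congr rfl fun _ _ => Finset.sum_comm

lemma trace_ptrA_mul [DecidableEq A] (ρ : Matrix (A × B) (A × B) ℂ) (Y : Matrix B B ℂ) :
    (ptrA ρ * Y).trace = (ρ * ((1 : Matrix A A ℂ) ⊗ₖ Y)).trace := by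
  simp only [trace, diag_apply, mul_apply, ptrA, kroneckerMap_apply, Fintype.sum_prod_type,
    one_apply, Finset.sum_mul, ite_mul, one_mul, zero_mul, mul_ite, mul_zero]
  simp only [Finset.sum_ite_irrel, Finset.sum_const_zero, Finset.sum_ite_eq', Finset.mem_univ,
    if_true]
  rw [Finset.sum_comm (s := (Finset.univ : Finset A))]
  exact Finset.sum_congr rfl fun _ _ => Finset.sum_comm

lemma trace_applyLocal_mul_kronecker (K : ι → Matrix A' A ℂ) (L : κ → Matrix B' B ℂ)
    (ρ : Matrix (A × B) (A × B) ℂ) (X : Matrix A' A' ℂ) (Z : Matrix B' B' ℂ) :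
    (applyLocal K L ρ * (X ⊗ₖ Z)).trace = (ρ * (krausDual K X ⊗ₖ krausDual L Z)).trace := by
  have hk : krausDual K X ⊗ₖ krausDual L Z =
      ∑ k, ∑ m, (K k ⊗ₖ L m)ᴴ * (X ⊗ₖ Z) * (K k ⊗ₖ L m) := by
    simp only [krausDual, conjTranspose_kronecker, ← mul_kronecker_mul]
    ext ⟨a, b⟩ ⟨c, d⟩
    simp [kroneckerMap_apply, Matrix.sum_apply, Finset.sum_mul_sum]
  rw [hk, applyLocal]
  simp only [Finset.sum_mul, Finset.mul_sum, trace_sum]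
  refine Finset.sum_congr rfl fun k _ => Finset.sum_congr rfl fun m _ => ?_
  rw [Matrix.mul_assoc, Matrix.mul_assoc, trace_mul_comm]
  simp only [Matrix.mul_assoc]

/-- The operator Schwarz inequality, as an identity with a manifestly positive remainder. -/
lemma krausDual_mul_conjTranspose [DecidableEq A] {K : ι → Matrix A' A ℂ}
    (hK : ∑ k, (K k)ᴴ * K k = 1) (X : Matrix A' A' ℂ) :
    krausDual K (X * Xᴴ) = krausDual K X * (krausDual K X)ᴴ +
      ∑ k, ((K k)ᴴ * X - krausDual K X * (K k)ᴴ) *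
        ((K k)ᴴ * X - krausDual K X * (K k)ᴴ)ᴴ := by
  set T := krausDual K X with hT
  have h1 : ∑ k, (K k)ᴴ * X * (K k * Tᴴ) = T * Tᴴ := by
    simp only [← Matrix.mul_assoc, ← Finset.sum_mul, hT, krausDual]
  have h2 : ∑ k, T * (K k)ᴴ * (Xᴴ * K k) = T * Tᴴ := by
    rw [hT, conjTranspose_krausDual, krausDual.eq_def K Xᴴ, Finset.mul_sum]
    simp only [Matrix.mul_assoc]
  have h3 : ∑ k, T * (K k)ᴴ * (K k * Tᴴ) = T * Tᴴ := by
    calc _ = T * (∑ k, (K k)ᴴ * K k) * Tᴴ := by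
          simp only [Finset.mul_sum, Finset.sum_mul, Matrix.mul_assoc]
      _ = _ := by rw [hK, Matrix.mul_one]
  have h4 : ∑ k, (K k)ᴴ * X * (Xᴴ * K k) = krausDual K (X * Xᴴ) := by
    simp only [krausDual, Matrix.mul_assoc]
  simp only [conjTranspose_sub, conjTranspose_mul, conjTranspose_conjTranspose, Matrix.sub_mul,
    Matrix.mul_sub, Finset.sum_sub_distrib, h1, h2, h3, h4]
  abel

lemma Matrix.PosSemidef.trace_mul_mul_conjTranspose_nonneg {m : Type*} [Fintype m]
    {ρ : Matrix n n ℂ} (hρ : ρ.PosSemidef) (M : Matrix n m ℂ) : 0 ≤ (ρ * (M * Mᴴ)).trace := by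
  rw [← Matrix.mul_assoc, trace_mul_comm, ← Matrix.mul_assoc]
  exact (hρ.conjTranspose_mul_mul_same M).trace_nonneg

lemma norm_trace_mul_sq_le (M N : Matrix n n ℂ) :
    ‖(M * N).trace‖ ^ 2 ≤ (M * Mᴴ).trace.re * (Nᴴ * N).trace.re := by
  have hn (P : Matrix n n ℂ) : ‖WithLp.toLp 2 fun p : n × n => P p.1 p.2‖ ^ 2 =
      (P * Pᴴ).trace.re := by
    simp [EuclideanSpace.norm_sq_eq, trace, mul_apply, Fintype.sum_prod_type, Complex.mul_conj,
      Complex.normSq_eq_norm_sq, -Complex.ofReal_pow]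
  have hi : (M * N).trace = inner ℂ (WithLp.toLp 2 fun p : n × n => Nᴴ p.1 p.2)
      (WithLp.toLp 2 fun p : n × n => M p.1 p.2) := by
    simp [PiLp.inner_apply, trace, mul_apply, Fintype.sum_prod_type]
  have hN := hn Nᴴ
  rw [conjTranspose_conjTranspose] at hN
  rw [← hn M, ← hN, ← mul_pow, hi, mul_comm]
  gcongr
  exact norm_inner_le_norm _ _

lemma Matrix.PosSemidef.norm_trace_mul_mul_sq_le {ρ : Matrix n n ℂ} (hρ : ρ.PosSemidef)
    (P Q : Matrix n n ℂ) :
    ‖(ρ * (P * Q)).trace‖ ^ 2 ≤ (ρ * (P * Pᴴ)).trace.re * (ρ * (Qᴴ * Q)).trace.re := by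
  classical
  obtain ⟨R, rfl⟩ : ∃ R : Matrix n n ℂ, ρ = Rᴴ * R := by
    open scoped MatrixOrder in exact CStarAlgebra.nonneg_iff_eq_star_mul_self.mp hρ.nonneg
  have h := norm_trace_mul_sq_le (R * P) (Q * Rᴴ)
  have h1 : ∀ S : Matrix n n ℂ, (Rᴴ * R * S).trace = (R * S * Rᴴ).trace := fun S => by
    rw [Matrix.mul_assoc, trace_mul_comm]
  rw [h1, h1, h1]
  simpa [Matrix.mul_assoc] using h

lemma norm_trace_mul_kronecker_sq_le {ρ : Matrix (A × B) (A × B) ℂ} (hρ : ρ.PosSemidef)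
    (X : Matrix A A ℂ) (Y : Matrix B B ℂ) :
    ‖(ρ * (X ⊗ₖ Yᴴ)).trace‖ ^ 2 ≤
      (ptrB ρ * (X * Xᴴ)).trace.re * (ptrA ρ * (Y * Yᴴ)).trace.re := by
  classical
  have h := hρ.norm_trace_mul_mul_sq_le (X ⊗ₖ (1 : Matrix B B ℂ)) ((1 : Matrix A A ℂ) ⊗ₖ Yᴴ)
  simpa [conjTranspose_kronecker, ← mul_kronecker_mul, trace_ptrB_mul, trace_ptrA_mul] using h

lemma trace_ptrB_mul_mul_conjTranspose_nonneg {ρ : Matrix (A × B) (A × B) ℂ}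
    (hρ : ρ.PosSemidef) {m : Type*} [Fintype m] (M : Matrix A m ℂ) :
    0 ≤ (ptrB ρ * (M * Mᴴ)).trace := by
  classical
  have h := hρ.trace_mul_mul_conjTranspose_nonneg (M ⊗ₖ (1 : Matrix B B ℂ))
  simpa [conjTranspose_kronecker, ← mul_kronecker_mul, trace_ptrB_mul] using h

lemma trace_ptrA_mul_mul_conjTranspose_nonneg {ρ : Matrix (A × B) (A × B) ℂ}
    (hρ : ρ.PosSemidef) {m : Type*} [Fintype m] (M : Matrix B m ℂ) :
    0 ≤ (ptrA ρ * (M * Mᴴ)).trace := by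
  classical
  have h := hρ.trace_mul_mul_conjTranspose_nonneg ((1 : Matrix A A ℂ) ⊗ₖ M)
  simpa [conjTranspose_kronecker, ← mul_kronecker_mul, trace_ptrA_mul] using h

lemma mu_nonneg (ρ : Matrix (A × B) (A × B) ℂ) : 0 ≤ mu ρ := by
  refine Real.sSup_nonneg ?_
  rintro _ ⟨X, Y, -, -, -, -, rfl⟩
  exact norm_nonneg _

lemma le_mu {ρ : Matrix (A × B) (A × B) ℂ} (hρ : ρ.PosSemidef)
    {X : Matrix A A ℂ} {Y : Matrix B B ℂ}
    (hX : (ptrB ρ * X).trace = 0) (hY : (ptrA ρ * Y).trace = 0)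
    (hX1 : (ptrB ρ * (X * Xᴴ)).trace = 1) (hY1 : (ptrA ρ * (Y * Yᴴ)).trace = 1) :
    ‖(ρ * (X ⊗ₖ Yᴴ)).trace‖ ≤ mu ρ := by
  refine le_csSup ⟨1, ?_⟩ ⟨X, Y, hX, hY, hX1, hY1, rfl⟩
  rintro _ ⟨X, Y, -, -, hX1, hY1, rfl⟩
  have h := norm_trace_mul_kronecker_sq_le hρ X Y
  rw [hX1, hY1] at h
  exact (sq_le_one_iff₀ (norm_nonneg _)).mp (by simpa using h)

/-- The defining bound of `mu` for observables of arbitrary variance. -/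
lemma norm_trace_mul_kronecker_le_mu {ρ : Matrix (A × B) (A × B) ℂ} (hρ : ρ.PosSemidef)
    {X : Matrix A A ℂ} {Y : Matrix B B ℂ}
    (hX : (ptrB ρ * X).trace = 0) (hY : (ptrA ρ * Y).trace = 0) :
    ‖(ρ * (X ⊗ₖ Yᴴ)).trace‖ ≤
      √(ptrB ρ * (X * Xᴴ)).trace.re * √(ptrA ρ * (Y * Yᴴ)).trace.re * mu ρ := by
  have ha := trace_ptrB_mul_mul_conjTranspose_nonneg hρ X
  have hb := trace_ptrA_mul_mul_conjTranspose_nonneg hρ Y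
  have hcs := norm_trace_mul_kronecker_sq_le hρ X Y
  obtain ⟨a, hae⟩ : ∃ a : ℝ, (ptrB ρ * (X * Xᴴ)).trace = a := ⟨_, Complex.eq_re_of_ofReal_le ha⟩
  obtain ⟨b, hbe⟩ : ∃ b : ℝ, (ptrA ρ * (Y * Yᴴ)).trace = b := ⟨_, Complex.eq_re_of_ofReal_le hb⟩
  rw [hae, hbe, Complex.ofReal_re, Complex.ofReal_re] at hcs ⊢
  have ha0 : 0 ≤ a := by simpa [hae] using ha
  have hb0 : 0 ≤ b := by simpa [hbe] using hb
  rcases ha0.eq_or_lt with rfl | ha0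
  · simp_all
  rcases hb0.eq_or_lt with rfl | hb0
  · simp_all
  have hsa : 0 < √a := Real.sqrt_pos.mpr ha0
  have hsb : 0 < √b := Real.sqrt_pos.mpr hb0
  have hscale {c : ℝ} (hc : 0 < c) : ((√c)⁻¹ : ℂ) * ((√c)⁻¹ * c) = 1 := by
    have : (√c)⁻¹ * ((√c)⁻¹ * c) = 1 := by
      have := Real.sqrt_pos.mpr hc
      field_simp
      exact (Real.sq_sqrt hc.le).symm
    exact_mod_cast this
  have h := le_mu hρ (X := ((√a)⁻¹ : ℂ) • X) (Y := ((√b)⁻¹ : ℂ) • Y)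
    (by simp [hX]) (by simp [hY])
    (by simpa [hae] using hscale ha0) (by simpa [hbe] using hscale hb0)
  simp only [conjTranspose_smul, smul_kronecker, kronecker_smul, Matrix.mul_smul, trace_smul,
    norm_smul, star_inv₀, norm_inv, norm_star, Complex.norm_real, Real.norm_eq_abs,
    abs_of_pos hsa, abs_of_pos hsb] at h
  rw [inv_mul_le_iff₀ hsb, inv_mul_le_iff₀ hsa] at h
  linarith

section Marginal

variable {K : ι → Matrix A' A ℂ} {L : κ → Matrix B' B ℂ}

lemma trace_ptrB_applyLocal_mul [DecidableEq B] (hL : ∑ m, (L m)ᴴ * L m = 1)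
    (ρ : Matrix (A × B) (A × B) ℂ) (X : Matrix A' A' ℂ) :
    (ptrB (applyLocal K L ρ) * X).trace = (ptrB ρ * krausDual K X).trace := by
  classical
  rw [trace_ptrB_mul, trace_applyLocal_mul_kronecker, trace_ptrB_mul, krausDual_one hL]

lemma trace_ptrA_applyLocal_mul [DecidableEq A] (hK : ∑ k, (K k)ᴴ * K k = 1)
    (ρ : Matrix (A × B) (A × B) ℂ) (Y : Matrix B' B' ℂ) :
    (ptrA (applyLocal K L ρ) * Y).trace = (ptrA ρ * krausDual L Y).trace := by
  classical
  rw [trace_ptrA_mul, trace_applyLocal_mul_kronecker, trace_ptrA_mul, krausDual_one hK]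

lemma trace_ptrB_mul_krausDual_le [DecidableEq A] {ρ : Matrix (A × B) (A × B) ℂ}
    (hρ : ρ.PosSemidef) (hK : ∑ k, (K k)ᴴ * K k = 1) (X : Matrix A' A' ℂ) :
    (ptrB ρ * (krausDual K X * (krausDual K X)ᴴ)).trace ≤
      (ptrB ρ * krausDual K (X * Xᴴ)).trace := by
  rw [krausDual_mul_conjTranspose hK, Matrix.mul_add, trace_add, Finset.mul_sum, trace_sum]
  exact le_add_of_nonneg_right <| Finset.sum_nonneg fun _ _ =>
    trace_ptrB_mul_mul_conjTranspose_nonneg hρ _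

lemma trace_ptrA_mul_krausDual_le [DecidableEq B] {ρ : Matrix (A × B) (A × B) ℂ}
    (hρ : ρ.PosSemidef) (hL : ∑ m, (L m)ᴴ * L m = 1) (Y : Matrix B' B' ℂ) :
    (ptrA ρ * (krausDual L Y * (krausDual L Y)ᴴ)).trace ≤
      (ptrA ρ * krausDual L (Y * Yᴴ)).trace := by
  rw [krausDual_mul_conjTranspose hL, Matrix.mul_add, trace_add, Finset.mul_sum, trace_sum]
  exact le_add_of_nonneg_right <| Finset.sum_nonneg fun _ _ =>
    trace_ptrA_mul_mul_conjTranspose_nonneg hρ _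

end Marginal

end Aux

/-- Data processing inequality for maximal correlation under local CPTP maps. -/
theorem mu_applyLocal_le {dA dB dA' dB' : ℕ} {ι κ : Type*} [Fintype ι] [Fintype κ]
    (ρ : Matrix (Fin dA × Fin dB) (Fin dA × Fin dB) ℂ) (hρ : IsDensity ρ)
    (K : ι → Matrix (Fin dA') (Fin dA) ℂ) (L : κ → Matrix (Fin dB') (Fin dB) ℂ)
    (hK : ∑ k, (K k)ᴴ * K k = 1) (hL : ∑ m, (L m)ᴴ * L m = 1)
    (σ : Matrix (Fin dA' × Fin dB') (Fin dA' × Fin dB') ℂ)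
    (hσ : σ = applyLocal K L ρ) :
    mu σ ≤ mu ρ := by
  subst hσ
  refine Real.sSup_le ?_ (mu_nonneg ρ)
  rintro _ ⟨X, Y, hX, hY, hX1, hY1, rfl⟩
  rw [trace_ptrB_applyLocal_mul hL] at hX hX1
  rw [trace_ptrA_applyLocal_mul hK] at hY hY1
  rw [trace_applyLocal_mul_kronecker, ← conjTranspose_krausDual]
  have ha := (Complex.le_def.mp (trace_ptrB_mul_krausDual_le hρ.1 hK X)).1
  have hb := (Complex.le_def.mp (trace_ptrA_mul_krausDual_le hρ.1 hL Y)).1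
  rw [hX1, Complex.one_re] at ha
  rw [hY1, Complex.one_re] at hb
  refine (norm_trace_mul_kronecker_le_mu hρ.1 hX hY).trans ?_
  exact mul_le_of_le_one_left (mu_nonneg ρ) <|
    mul_le_one₀ (Real.sqrt_le_one.mpr ha) (Real.sqrt_nonneg _) (Real.sqrt_le_one.mpr hb)
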